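/- arXiv:2605.06277 — 4 statements merged into one kernel-verified Lean document; each statement's English description precedes it below -/
import Mathlib

section
/- Let g₁, g₂ : (0,∞) → (0,∞) be functions (playing the role of the inverses Φ₁⁻¹, Φ₂⁻¹ of two growth functions), where g₁ is log-convex up to a constant C₁ ≥ 1 and g₂ is log-concave up to a constant C₂ ≥ 1. Then the set E = { (α,β) ∈ ℝ² : α ≥ −1, β ≥ −1, and there exist constants C > 0 and K > 0 such that g₁(t^{2+α}) ≤ C · g₂(K · t^{2+β}) for all t > 0 } is a convex subset of ℝ². -/
/-- For `g₁` log-convex up to a constant `C₁ ≥ 1` and `g₂` log-concave up to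
a constant `C₂ ≥ 1` (on `(0,∞)`), the set
`E = {(α,β) : α ≥ -1, β ≥ -1, ∃ C > 0, K > 0, ∀ t > 0, g₁ (t^(2+α)) ≤ C * g₂ (K * t^(2+β))}`
is a convex subset of `ℝ²`. -/
theorem stmt0 (g₁ g₂ : ℝ → ℝ) (C₁ C₂ : ℝ) (hC₁ : 1 ≤ C₁) (hC₂ : 1 ≤ C₂)
    (hg₁pos : ∀ t > (0:ℝ), 0 < g₁ t) (hg₂pos : ∀ t > (0:ℝ), 0 < g₂ t)
    (hg₁ : ∀ u > (0:ℝ), ∀ v > (0:ℝ), ∀ θ ∈ Set.Icc (0:ℝ) 1,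
      g₁ (u ^ θ * v ^ (1 - θ)) ≤ C₁ ^ (θ * (1 - θ)) * g₁ u ^ θ * g₁ v ^ (1 - θ))
    (hg₂ : ∀ u > (0:ℝ), ∀ v > (0:ℝ), ∀ θ ∈ Set.Icc (0:ℝ) 1,
      g₂ u ^ θ * g₂ v ^ (1 - θ) ≤ g₂ (C₂ ^ (θ * (1 - θ)) * (u ^ θ * v ^ (1 - θ)))) :
    Convex ℝ { p : ℝ × ℝ | -1 ≤ p.1 ∧ -1 ≤ p.2 ∧
      ∃ C > (0:ℝ), ∃ K > (0:ℝ), ∀ t > (0:ℝ),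
        g₁ (t ^ (2 + p.1)) ≤ C * g₂ (K * t ^ (2 + p.2)) } := by
  rintro ⟨α, β⟩ ⟨hα, hβ, C, hC, K, hK, h⟩ ⟨α', β'⟩ ⟨hα', hβ', C', hC', K', hK', h'⟩ a b ha hb hab
  obtain rfl : b = 1 - a := by linarith
  dsimp only at hα hβ h hα' hβ' h'
  have hC₁pos : 0 < C₁ := by linarith
  have hC₂pos : 0 < C₂ := by linarith
  have rpow_comb (t : ℝ) (ht : 0 < t) (x y : ℝ) :
      t ^ (2 + (a * x + (1 - a) * y)) = (t ^ (2 + x)) ^ a * (t ^ (2 + y)) ^ (1 - a) := by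
    rw [← Real.rpow_mul ht.le, ← Real.rpow_mul ht.le, ← Real.rpow_add ht]
    ring_nf
  simp only [Set.mem_ofPred_eq, Prod.smul_mk, Prod.mk_add_mk, smul_eq_mul]
  refine ⟨by nlinarith, by nlinarith, C₁ ^ (a * (1 - a)) * (C ^ a * C' ^ (1 - a)), by positivity,
    C₂ ^ (a * (1 - a)) * (K ^ a * K' ^ (1 - a)), by positivity, fun t ht ↦ ?_⟩
  have ha' : a ∈ Set.Icc (0 : ℝ) 1 := ⟨ha, by linarith⟩
  have hu : 0 < t ^ (2 + α) := by positivity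
  have hv : 0 < t ^ (2 + α') := by positivity
  have hw : 0 < K * t ^ (2 + β) := by positivity
  have hz : 0 < K' * t ^ (2 + β') := by positivity
  have hgu := hg₁pos _ hu
  have hgv := hg₁pos _ hv
  have hgw := hg₂pos _ hw
  have hgz := hg₂pos _ hz
  calc g₁ (t ^ (2 + (a * α + (1 - a) * α')))
      = g₁ ((t ^ (2 + α)) ^ a * (t ^ (2 + α')) ^ (1 - a)) := by rw [rpow_comb t ht]
    _ ≤ C₁ ^ (a * (1 - a)) * g₁ (t ^ (2 + α)) ^ a * g₁ (t ^ (2 + α')) ^ (1 - a) :=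
        hg₁ _ hu _ hv a ha'
    _ ≤ C₁ ^ (a * (1 - a)) * (C * g₂ (K * t ^ (2 + β))) ^ a *
          (C' * g₂ (K' * t ^ (2 + β'))) ^ (1 - a) := by
        gcongr
        · exact h t ht
        · exact h' t ht
    _ = C₁ ^ (a * (1 - a)) * (C ^ a * C' ^ (1 - a)) *
          (g₂ (K * t ^ (2 + β)) ^ a * g₂ (K' * t ^ (2 + β')) ^ (1 - a)) := by
        rw [Real.mul_rpow hC.le hgw.le, Real.mul_rpow hC'.le hgz.le]
        ring
    _ ≤ C₁ ^ (a * (1 - a)) * (C ^ a * C' ^ (1 - a)) *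
          g₂ (C₂ ^ (a * (1 - a)) * ((K * t ^ (2 + β)) ^ a * (K' * t ^ (2 + β')) ^ (1 - a))) := by
        gcongr
        exact hg₂ _ hw _ hz a ha'
    _ = C₁ ^ (a * (1 - a)) * (C ^ a * C' ^ (1 - a)) *
          g₂ (C₂ ^ (a * (1 - a)) * (K ^ a * K' ^ (1 - a)) *
            t ^ (2 + (a * β + (1 - a) * β'))) := by
        rw [rpow_comb t ht, Real.mul_rpow hK.le (by positivity),
          Real.mul_rpow hK'.le (by positivity)]
        congr 2
        ring
end

section
/- Let g₁, g₂ : (0,∞) → (0,∞) be functions, where g₁ is log-convex up to a constant C₁ ≥ 1 and g₂ is log-concave up to a constant C₂ ≥ 1. Suppose α₀, β₀, α₁, β₁ ∈ ℝ and M₀, K₀, M₁, K₁ > 0 satisfy g₁(t^{2+α₀}) ≤ M₀ · g₂(K₀ · t^{2+β₀}) for all t > 0 and g₁(t^{2+α₁}) ≤ M₁ · g₂(K₁ · t^{2+β₁}) for all t > 0. Then for every θ ∈ [0,1], setting α_θ = (1−θ)α₀ + θα₁ and β_θ = (1−θ)β₀ + θβ₁, one has g₁(t^{2+α_θ}) ≤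 C_θ · g₂(K_θ · t^{2+β_θ}) for all t > 0, where C_θ = M₀^{1−θ} · M₁^θ · C₁^{θ(1−θ)} and K_θ = C₂^{θ(1−θ)} · K₀^{1−θ} · K₁^θ. -/
/-- quantitative convexity step for the set `E`: if the embedding inequality
holds at two parameter pairs `(α₀,β₀)` and `(α₁,β₁)` with constants `(M₀,K₀)` and `(M₁,K₁)`,
then it holds at each interpolated pair `(α_θ, β_θ)` with constants
`C_θ = M₀^(1-θ) M₁^θ C₁^(θ(1-θ))` and `K_θ = C₂^(θ(1-θ)) K₀^(1-θ) K₁^θ`. -/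
theorem stmt1 (g₁ g₂ : ℝ → ℝ) (C₁ C₂ : ℝ) (hC₁ : 1 ≤ C₁) (hC₂ : 1 ≤ C₂)
    (hg₁pos : ∀ t > (0:ℝ), 0 < g₁ t) (hg₂pos : ∀ t > (0:ℝ), 0 < g₂ t)
    (hg₁ : ∀ u > (0:ℝ), ∀ v > (0:ℝ), ∀ θ ∈ Set.Icc (0:ℝ) 1,
      g₁ (u ^ θ * v ^ (1 - θ)) ≤ C₁ ^ (θ * (1 - θ)) * g₁ u ^ θ * g₁ v ^ (1 - θ))
    (hg₂ : ∀ u > (0:ℝ), ∀ v > (0:ℝ), ∀ θ ∈ Set.Icc (0:ℝ) 1,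
      g₂ u ^ θ * g₂ v ^ (1 - θ) ≤ g₂ (C₂ ^ (θ * (1 - θ)) * (u ^ θ * v ^ (1 - θ))))
    (α₀ β₀ α₁ β₁ : ℝ) (M₀ K₀ M₁ K₁ : ℝ)
    (hM₀ : 0 < M₀) (hK₀ : 0 < K₀) (hM₁ : 0 < M₁) (hK₁ : 0 < K₁)
    (h₀ : ∀ t > (0:ℝ), g₁ (t ^ (2 + α₀)) ≤ M₀ * g₂ (K₀ * t ^ (2 + β₀)))
    (h₁ : ∀ t > (0:ℝ), g₁ (t ^ (2 + α₁)) ≤ M₁ * g₂ (K₁ * t ^ (2 + β₁))) :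
    ∀ θ ∈ Set.Icc (0:ℝ) 1, ∀ t > (0:ℝ),
      g₁ (t ^ (2 + ((1 - θ) * α₀ + θ * α₁))) ≤
        (M₀ ^ (1 - θ) * M₁ ^ θ * C₁ ^ (θ * (1 - θ))) *
          g₂ ((C₂ ^ (θ * (1 - θ)) * K₀ ^ (1 - θ) * K₁ ^ θ) *
            t ^ (2 + ((1 - θ) * β₀ + θ * β₁))) := by
  intro θ hθ t ht
  have hθ' : 0 ≤ 1 - θ := sub_nonneg.2 hθ.2
  have hC₁0 : 0 < C₁ := by linarith
  have interp : ∀ a b : ℝ, t ^ (2 + ((1 - θ) * a + θ * b)) =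
      (t ^ (2 + b)) ^ θ * (t ^ (2 + a)) ^ (1 - θ) := fun a b ↦ by
    rw [← Real.rpow_mul ht.le, ← Real.rpow_mul ht.le, ← Real.rpow_add ht]
    congr 1
    ring
  have pow_pos : ∀ a : ℝ, 0 < t ^ a := Real.rpow_pos_of_pos ht
  have hu := mul_pos hK₁ (pow_pos (2 + β₁))
  have hv := mul_pos hK₀ (pow_pos (2 + β₀))
  have hgu := (hg₂pos _ hu).le
  have hgv := (hg₂pos _ hv).le
  have hg₁u := (hg₁pos _ (pow_pos (2 + α₁))).le
  have hg₁v := (hg₁pos _ (pow_pos (2 + α₀))).le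
  calc g₁ (t ^ (2 + ((1 - θ) * α₀ + θ * α₁)))
      ≤ C₁ ^ (θ * (1 - θ)) * g₁ (t ^ (2 + α₁)) ^ θ * g₁ (t ^ (2 + α₀)) ^ (1 - θ) := by
        rw [interp]
        exact hg₁ _ (pow_pos _) _ (pow_pos _) θ hθ
    _ ≤ C₁ ^ (θ * (1 - θ)) * (M₁ * g₂ (K₁ * t ^ (2 + β₁))) ^ θ *
          (M₀ * g₂ (K₀ * t ^ (2 + β₀))) ^ (1 - θ) := by
        have e₁ := Real.rpow_le_rpow hg₁u (h₁ t ht) hθ.1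
        have e₀ := Real.rpow_le_rpow hg₁v (h₀ t ht) hθ'
        gcongr
    _ = M₀ ^ (1 - θ) * M₁ ^ θ * C₁ ^ (θ * (1 - θ)) *
          (g₂ (K₁ * t ^ (2 + β₁)) ^ θ * g₂ (K₀ * t ^ (2 + β₀)) ^ (1 - θ)) := by
        rw [Real.mul_rpow hM₁.le hgu, Real.mul_rpow hM₀.le hgv]
        ring
    _ ≤ M₀ ^ (1 - θ) * M₁ ^ θ * C₁ ^ (θ * (1 - θ)) *
          g₂ (C₂ ^ (θ * (1 - θ)) *
            ((K₁ * t ^ (2 + β₁)) ^ θ * (K₀ * t ^ (2 + β₀)) ^ (1 - θ))) := by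
        gcongr
        exact hg₂ _ hu _ hv θ hθ
    _ = _ := by
        rw [interp, Real.mul_rpow hK₁.le (pow_pos _).le, Real.mul_rpow hK₀.le (pow_pos _).le]
        congr 2
        ring
end

section
/- Let g₁, g₂ : (0,∞) → (0,∞) be functions, where g₁ is log-convex up to a constant C₁ ≥ 1 and g₂ is log-concave up to a constant C₂ ≥ 1, and define E₁ = { (α,β) ∈ ℝ² : α ≥ −1, β ≥ −1, and there exist constants C > 0 and K > 0 such that g₁(t^{2+α}) ≤ C · g₂(K · t^{2+β}) for all t ≥ 1 }. For α ≥ −1 define β*(α) = inf { β ≥ −1 : (α,β) ∈ E₁ }. Then β* is convex on the set of α whose fiber is nonempty: for all α₀, α₁ ≥ −1 such that there exist β₀ with (α₀,β₀) ∈ E₁ and β₁ with (α₁,β₁) ∈ E₁, and all θ ∈ [0,1], one has β*((1−θ)α₀ + θα₁) ≤ (1−θ)·β*(α₀) + θ·β*(α₁). -/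
/-- A weighted geometric mean of two dilated powers of `t` is again a dilated power of `t`. -/
theorem mul_rpow_weighted_geom_mean {K₀ K₁ t a b θ : ℝ} (hK₀ : 0 < K₀) (hK₁ : 0 < K₁)
    (ht : 0 < t) :
    (K₁ * t ^ (2 + b)) ^ θ * (K₀ * t ^ (2 + a)) ^ (1 - θ) =
      K₁ ^ θ * K₀ ^ (1 - θ) * t ^ (2 + ((1 - θ) * a + θ * b)) := by
  rw [Real.mul_rpow hK₁.le (by positivity), Real.mul_rpow hK₀.le (by positivity),
    ← Real.rpow_mul ht.le, ← Real.rpow_mul ht.le,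
    show 2 + ((1 - θ) * a + θ * b) = (2 + b) * θ + (2 + a) * (1 - θ) by ring,
    Real.rpow_add ht]
  ring

/-- The domination `g₁ (t ^ (2 + α)) ≤ C * g₂ (K * t ^ (2 + β))` for `t ≥ 1` is stable under
convex combinations of `(α, β)`. -/
theorem exists_dominated_convex_combination {g₁ g₂ : ℝ → ℝ} {C₁ C₂ : ℝ}
    (hC₁ : 1 ≤ C₁) (hC₂ : 1 ≤ C₂)
    (hg₁pos : ∀ t > (0:ℝ), 0 < g₁ t) (hg₂pos : ∀ t > (0:ℝ), 0 < g₂ t)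
    (hg₁ : ∀ u > (0:ℝ), ∀ v > (0:ℝ), ∀ θ ∈ Set.Icc (0:ℝ) 1,
      g₁ (u ^ θ * v ^ (1 - θ)) ≤ C₁ ^ (θ * (1 - θ)) * g₁ u ^ θ * g₁ v ^ (1 - θ))
    (hg₂ : ∀ u > (0:ℝ), ∀ v > (0:ℝ), ∀ θ ∈ Set.Icc (0:ℝ) 1,
      g₂ u ^ θ * g₂ v ^ (1 - θ) ≤ g₂ (C₂ ^ (θ * (1 - θ)) * (u ^ θ * v ^ (1 - θ))))
    {α₀ α₁ β₀ β₁ : ℝ}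
    (h₀ : ∃ C > (0:ℝ), ∃ K > (0:ℝ), ∀ t ≥ (1:ℝ), g₁ (t ^ (2 + α₀)) ≤ C * g₂ (K * t ^ (2 + β₀)))
    (h₁ : ∃ C > (0:ℝ), ∃ K > (0:ℝ), ∀ t ≥ (1:ℝ), g₁ (t ^ (2 + α₁)) ≤ C * g₂ (K * t ^ (2 + β₁)))
    {θ : ℝ} (hθ : θ ∈ Set.Icc (0:ℝ) 1) :
    ∃ C > (0:ℝ), ∃ K > (0:ℝ), ∀ t ≥ (1:ℝ),
      g₁ (t ^ (2 + ((1 - θ) * α₀ + θ * α₁))) ≤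
        C * g₂ (K * t ^ (2 + ((1 - θ) * β₀ + θ * β₁))) := by
  obtain ⟨A₀, hA₀, K₀, hK₀, h₀⟩ := h₀
  obtain ⟨A₁, hA₁, K₁, hK₁, h₁⟩ := h₁
  have hC₁' : 0 < C₁ := by linarith
  have hC₂' : 0 < C₂ := by linarith
  have hθ' : 0 ≤ 1 - θ := by linarith [hθ.2]
  refine ⟨C₁ ^ (θ * (1 - θ)) * (A₁ ^ θ * A₀ ^ (1 - θ)), by positivity,
    C₂ ^ (θ * (1 - θ)) * (K₁ ^ θ * K₀ ^ (1 - θ)), by positivity, fun t ht ↦ ?_⟩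
  have ht' : 0 < t := by linarith
  have hu₀ : 0 < K₀ * t ^ (2 + β₀) := by positivity
  have hu₁ : 0 < K₁ * t ^ (2 + β₁) := by positivity
  have hs₀ : 0 < t ^ (2 + α₀) := by positivity
  have hs₁ : 0 < t ^ (2 + α₁) := by positivity
  have hpow := mul_rpow_weighted_geom_mean (a := α₀) (b := α₁) (θ := θ) one_pos one_pos ht'
  simp only [one_mul, Real.one_rpow] at hpow
  have hx₀ := (hg₁pos _ hs₀).le
  have hx₁ := (hg₁pos _ hs₁).le
  have hy₀ := (hg₂pos _ hu₀).le
  have hy₁ := (hg₂pos _ hu₁).le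
  calc g₁ (t ^ (2 + ((1 - θ) * α₀ + θ * α₁)))
      ≤ C₁ ^ (θ * (1 - θ)) * g₁ (t ^ (2 + α₁)) ^ θ * g₁ (t ^ (2 + α₀)) ^ (1 - θ) :=
        hpow ▸ hg₁ _ hs₁ _ hs₀ θ hθ
    _ ≤ C₁ ^ (θ * (1 - θ)) * (A₁ * g₂ (K₁ * t ^ (2 + β₁))) ^ θ *
          (A₀ * g₂ (K₀ * t ^ (2 + β₀))) ^ (1 - θ) := by
        have e₁ := Real.rpow_le_rpow hx₁ (h₁ t ht) hθ.1
        have e₀ := Real.rpow_le_rpow hx₀ (h₀ t ht) hθ'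
        gcongr
    _ = C₁ ^ (θ * (1 - θ)) * (A₁ ^ θ * A₀ ^ (1 - θ)) *
          (g₂ (K₁ * t ^ (2 + β₁)) ^ θ * g₂ (K₀ * t ^ (2 + β₀)) ^ (1 - θ)) := by
        rw [Real.mul_rpow hA₁.le hy₁, Real.mul_rpow hA₀.le hy₀]
        ring
    _ ≤ C₁ ^ (θ * (1 - θ)) * (A₁ ^ θ * A₀ ^ (1 - θ)) *
          g₂ (C₂ ^ (θ * (1 - θ)) * (K₁ ^ θ * K₀ ^ (1 - θ)) *
            t ^ (2 + ((1 - θ) * β₀ + θ * β₁))) := by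
        rw [mul_assoc (C₂ ^ _), ← mul_rpow_weighted_geom_mean hK₀ hK₁ ht']
        gcongr
        exact hg₂ _ hu₁ _ hu₀ θ hθ

/-- for `g₁` log-convex up to `C₁ ≥ 1` and `g₂` log-concave up to `C₂ ≥ 1`,
the boundary function `β*(α) = inf {β ≥ -1 : (α,β) ∈ E₁}` is convex on the set of `α`
with nonempty fiber. -/
theorem stmt3 (g₁ g₂ : ℝ → ℝ) (C₁ C₂ : ℝ) (hC₁ : 1 ≤ C₁) (hC₂ : 1 ≤ C₂)
    (hg₁pos : ∀ t > (0:ℝ), 0 < g₁ t) (hg₂pos : ∀ t > (0:ℝ), 0 < g₂ t)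
    (hg₁ : ∀ u > (0:ℝ), ∀ v > (0:ℝ), ∀ θ ∈ Set.Icc (0:ℝ) 1,
      g₁ (u ^ θ * v ^ (1 - θ)) ≤ C₁ ^ (θ * (1 - θ)) * g₁ u ^ θ * g₁ v ^ (1 - θ))
    (hg₂ : ∀ u > (0:ℝ), ∀ v > (0:ℝ), ∀ θ ∈ Set.Icc (0:ℝ) 1,
      g₂ u ^ θ * g₂ v ^ (1 - θ) ≤ g₂ (C₂ ^ (θ * (1 - θ)) * (u ^ θ * v ^ (1 - θ))))
    (E₁ : Set (ℝ × ℝ))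
    (hE₁ : E₁ = { p : ℝ × ℝ | -1 ≤ p.1 ∧ -1 ≤ p.2 ∧
      ∃ C > (0:ℝ), ∃ K > (0:ℝ), ∀ t ≥ (1:ℝ),
        g₁ (t ^ (2 + p.1)) ≤ C * g₂ (K * t ^ (2 + p.2)) })
    (βstar : ℝ → ℝ)
    (hβstar : ∀ α, βstar α = sInf { β : ℝ | -1 ≤ β ∧ (α, β) ∈ E₁ })
    (α₀ α₁ : ℝ) (hα₀ : -1 ≤ α₀) (hα₁ : -1 ≤ α₁)
    (hfib₀ : ∃ β₀, (α₀, β₀) ∈ E₁) (hfib₁ : ∃ β₁, (α₁, β₁) ∈ E₁)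
    (θ : ℝ) (hθ : θ ∈ Set.Icc (0:ℝ) 1) :
    βstar ((1 - θ) * α₀ + θ * α₁) ≤ (1 - θ) * βstar α₀ + θ * βstar α₁ := by
  obtain ⟨hθ0, hθ1⟩ := hθ
  have hne₀ : { β : ℝ | -1 ≤ β ∧ (α₀, β) ∈ E₁ }.Nonempty := by
    obtain ⟨β, hβ⟩ := hfib₀
    exact ⟨β, (hE₁ ▸ hβ :).2.1, hβ⟩
  have hne₁ : { β : ℝ | -1 ≤ β ∧ (α₁, β) ∈ E₁ }.Nonempty := by
    obtain ⟨β, hβ⟩ := hfib₁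
    exact ⟨β, (hE₁ ▸ hβ :).2.1, hβ⟩
  rw [hβstar, hβstar, hβstar]
  refine le_of_forall_pos_le_add fun ε hε ↦ ?_
  obtain ⟨β₀, ⟨hβ₀, hm₀⟩, hlt₀⟩ := exists_lt_of_csInf_lt hne₀ (lt_add_of_pos_right _ hε)
  obtain ⟨β₁, ⟨hβ₁, hm₁⟩, hlt₁⟩ := exists_lt_of_csInf_lt hne₁ (lt_add_of_pos_right _ hε)
  have hβ : -1 ≤ (1 - θ) * β₀ + θ * β₁ := by nlinarith
  have hα : -1 ≤ (1 - θ) * α₀ + θ * α₁ := by nlinarith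
  have hmem : ((1 - θ) * α₀ + θ * α₁, (1 - θ) * β₀ + θ * β₁) ∈ E₁ := by
    rw [hE₁] at hm₀ hm₁ ⊢
    exact ⟨hα, hβ, exists_dominated_convex_combination hC₁ hC₂ hg₁pos hg₂pos hg₁ hg₂
      hm₀.2.2 hm₁.2.2 ⟨hθ0, hθ1⟩⟩
  have hle : sInf { β : ℝ | -1 ≤ β ∧ ((1 - θ) * α₀ + θ * α₁, β) ∈ E₁ } ≤
      (1 - θ) * β₀ + θ * β₁ := csInf_le ⟨-1, fun _ h ↦ h.1⟩ ⟨hβ, hmem⟩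
  have e₀ := mul_le_mul_of_nonneg_left hlt₀.le (sub_nonneg.2 hθ1)
  have e₁ := mul_le_mul_of_nonneg_left hlt₁.le hθ0
  linarith
end

section
/- Let Φ, Ψ : [0,∞) → [0,∞) be strictly increasing bijections that are differentiable on (0,∞) with Φ′(t) > 0 and Ψ′(t) > 0 for all t > 0, and suppose there exists a real number c such that for all t > 0, t·Ψ′(t)/Ψ(t) ≥ c and t·Φ′(t)/Φ(t) ≤ c (that is, a_Ψ ≥ b_Φ for the Matuszewska–Orlicz indices). Then the ratio of inverse functions t ↦ Φ⁻¹(t)/Ψ⁻¹(t) is nondecreasing on (0,∞). -/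
/-- A lower bound `c ≤ t f'(t) / f(t)` makes `log f - c log` nondecreasing. -/
theorem monotoneOn_log_sub_mul_log {f f' : ℝ → ℝ} {c : ℝ} (hpos : ∀ t > (0 : ℝ), 0 < f t)
    (hf : ∀ t > (0 : ℝ), HasDerivAt f (f' t) t) (hc : ∀ t > (0 : ℝ), c ≤ t * f' t / f t) :
    MonotoneOn (fun t => Real.log (f t) - c * Real.log t) (Set.Ioi 0) := by
  have hd : ∀ t > (0 : ℝ), HasDerivAt (fun t => Real.log (f t) - c * Real.log t)
      (f' t / f t - c * t⁻¹) t := fun t ht =>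
    ((hf t ht).log (hpos t ht).ne').sub ((Real.hasDerivAt_log (ne_of_gt ht)).const_mul c)
  refine monotoneOn_of_deriv_nonneg (convex_Ioi 0)
    (fun t ht => (hd t ht).continuousAt.continuousWithinAt) ?_ ?_
  · rw [interior_Ioi]
    exact fun t ht => (hd t ht).differentiableAt.differentiableWithinAt
  · rw [interior_Ioi]
    intro t ht
    have ht' : (0 : ℝ) < t := ht
    rw [(hd t ht).deriv, sub_nonneg, ← div_eq_mul_inv, div_le_iff₀ ht']
    exact (hc t ht).trans_eq (by ring)

/-- An upper bound `t f'(t) / f(t) ≤ c` makes `log f - c log` nonincreasing. -/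
theorem antitoneOn_log_sub_mul_log {f f' : ℝ → ℝ} {c : ℝ} (hpos : ∀ t > (0 : ℝ), 0 < f t)
    (hf : ∀ t > (0 : ℝ), HasDerivAt f (f' t) t) (hc : ∀ t > (0 : ℝ), t * f' t / f t ≤ c) :
    AntitoneOn (fun t => Real.log (f t) - c * Real.log t) (Set.Ioi 0) := by
  have hmono := monotoneOn_log_sub_mul_log (f := fun t => (f t)⁻¹)
    (f' := fun t => -f' t / f t ^ 2) (c := -c) (fun t ht => inv_pos.2 (hpos t ht))
    (fun t ht => (hf t ht).fun_inv (hpos t ht).ne') (fun t ht => by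
      have hne := (hpos t ht).ne'
      have heq : t * (-f' t / f t ^ 2) / (f t)⁻¹ = -(t * f' t / f t) := by field_simp
      rw [heq]
      exact neg_le_neg (hc t ht))
  intro x hx y hy hxy
  have h := hmono hx hy hxy
  simp only [Real.log_inv] at h
  dsimp only
  linarith

/-- The inverse of a bijection of `[0, ∞)` that is positive on `(0, ∞)` preserves `(0, ∞)`. -/
theorem inv_pos_and_apply_inv_of_bijOn {f g : ℝ → ℝ}
    (hbij : Set.BijOn f (Set.Ici 0) (Set.Ici 0)) (hinv : Set.InvOn g f (Set.Ici 0) (Set.Ici 0))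
    (hpos : ∀ t > (0 : ℝ), 0 < f t) {x : ℝ} (hx : 0 < x) : 0 < g x ∧ f (g x) = x := by
  have hzero : f 0 = 0 := by
    obtain ⟨z, hz, hfz⟩ := hbij.surjOn (Set.mem_Ici.2 le_rfl)
    rcases (Set.mem_Ici.1 hz).eq_or_lt with rfl | hz'
    · exact hfz
    · exact absurd hfz (hpos z hz').ne'
  have hfg : f (g x) = x := hinv.2 (Set.mem_Ici.2 hx.le)
  have hg : 0 ≤ g x := (hinv.1.mapsTo hbij.surjOn) (Set.mem_Ici.2 hx.le)
  refine ⟨hg.lt_of_ne fun h => ?_, hfg⟩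
  rw [← h, hzero] at hfg
  exact hx.ne hfg

/-- let `Φ, Ψ : [0,∞) → [0,∞)` be strictly increasing bijections,
differentiable on `(0,∞)` with positive derivatives, and suppose there is a real `c` with
`t·Ψ'(t)/Ψ(t) ≥ c ≥ t·Φ'(t)/Φ(t)` for all `t > 0` (i.e. `a_Ψ ≥ b_Φ`). Then the ratio of
inverses `t ↦ Φ⁻¹(t)/Ψ⁻¹(t)` is nondecreasing on `(0,∞)`. -/
theorem stmt11 (Φ Ψ Φinv Ψinv Φ' Ψ' : ℝ → ℝ)
    (hΦmono : StrictMonoOn Φ (Set.Ici 0)) (hΨmono : StrictMonoOn Ψ (Set.Ici 0))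
    (hΦbij : Set.BijOn Φ (Set.Ici 0) (Set.Ici 0))
    (hΨbij : Set.BijOn Ψ (Set.Ici 0) (Set.Ici 0))
    (hΦinv : Set.InvOn Φinv Φ (Set.Ici 0) (Set.Ici 0))
    (hΨinv : Set.InvOn Ψinv Ψ (Set.Ici 0) (Set.Ici 0))
    (hΦpos : ∀ t > (0:ℝ), 0 < Φ t) (hΨpos : ∀ t > (0:ℝ), 0 < Ψ t)
    (hΦdiff : ∀ t > (0:ℝ), HasDerivAt Φ (Φ' t) t)
    (hΨdiff : ∀ t > (0:ℝ), HasDerivAt Ψ (Ψ' t) t)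
    (hΦ'pos : ∀ t > (0:ℝ), 0 < Φ' t) (hΨ'pos : ∀ t > (0:ℝ), 0 < Ψ' t)
    (c : ℝ)
    (hΨidx : ∀ t > (0:ℝ), c ≤ t * Ψ' t / Ψ t)
    (hΦidx : ∀ t > (0:ℝ), t * Φ' t / Φ t ≤ c) :
    MonotoneOn (fun t => Φinv t / Ψinv t) (Set.Ioi 0) := by
  have hlt : ∀ {x y : ℝ}, 0 < x → x < y → Φinv x / Ψinv x ≤ Φinv y / Ψinv y := by
    intro x y hx hxy
    have hy : 0 < y := hx.trans hxy
    obtain ⟨ha, hΦa⟩ := inv_pos_and_apply_inv_of_bijOn hΦbij hΦinv hΦpos hx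
    obtain ⟨hb, hΦb⟩ := inv_pos_and_apply_inv_of_bijOn hΦbij hΦinv hΦpos hy
    obtain ⟨hp, hΨp⟩ := inv_pos_and_apply_inv_of_bijOn hΨbij hΨinv hΨpos hx
    obtain ⟨hq, hΨq⟩ := inv_pos_and_apply_inv_of_bijOn hΨbij hΨinv hΨpos hy
    have hab : Φinv x < Φinv y :=
      (hΦmono.lt_iff_lt ha.le hb.le).1 (by rwa [hΦa, hΦb])
    have hpq : Ψinv x < Ψinv y :=
      (hΨmono.lt_iff_lt hp.le hq.le).1 (by rwa [hΨp, hΨq])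
    have h₁ := antitoneOn_log_sub_mul_log hΦpos hΦdiff hΦidx ha hb hab.le
    have h₂ := monotoneOn_log_sub_mul_log hΨpos hΨdiff hΨidx hp hq hpq.le
    simp only [hΦa, hΦb] at h₁
    simp only [hΨp, hΨq] at h₂
    have hc : 0 < c := lt_of_lt_of_le
      (div_pos (mul_pos one_pos (hΦ'pos 1 one_pos)) (hΦpos 1 one_pos)) (hΦidx 1 one_pos)
    rw [← Real.log_le_log_iff (div_pos ha hp) (div_pos hb hq), Real.log_div ha.ne' hp.ne',
      Real.log_div hb.ne' hq.ne']
    refine le_of_mul_le_mul_left ?_ hc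
    linarith
  intro x hx y _ hxy
  rcases hxy.eq_or_lt with rfl | hxy
  · exact le_rfl
  · exact hlt hx hxy
end
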